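/- arXiv:2311.08288 — 2 statements merged into one kernel-verified Lean document; each statement's English description precedes it below -/
import Mathlib

section
/- Let p be a prime power, and let W be a (k+t)-dimensional vector space over F_p. Let V and V' be two distinct t-dimensional subspaces of W with dim(V ∩ V') = ℓ, where 0 ≤ ℓ ≤ t-1. Then for any j with ℓ ≤ j ≤ t, the number of k-dimensional subspaces U of W with V' ⊆ U and dim(U ∩ V) = j equals p^{(t-j)(k-t-j+ℓ)} · [t-ℓ choose j-ℓ]_p · [k+ℓ-t choose j]_p. -/
/-- The Gaussian binomial coefficient `[n choose k]_p`, defined via the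
`q`-Pascal recurrence; it equals `0` when `k > n`. -/
def gbin (p : ℕ) : ℕ → ℕ → ℕ
  | _, 0 => 1
  | 0, _ + 1 => 0
  | n + 1, k + 1 => gbin p n k + p ^ (k + 1) * gbin p n (k + 1)

open Module in
theorem finrank_map_aux {F W : Type*} [Field F] [AddCommGroup W] [Module F W]
    [FiniteDimensional F W] (X S : Submodule F W) :
    finrank F (S.map X.mkQ) + finrank F ↥(S ⊓ X) = finrank F S := by
  have h := LinearMap.finrank_range_add_finrank_ker (X.mkQ.domRestrict S)
  rw [← h, LinearMap.range_domRestrict]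
  congr 1
  have e : LinearMap.ker (X.mkQ.domRestrict S) = (S ⊓ X).comap S.subtype := by
    ext x; simp [LinearMap.mem_ker]
  rw [e]
  exact (LinearEquiv.finrank_eq (Submodule.comapSubtypeEquivOfLe inf_le_left)).symm

open Module in
theorem finrank_comap_aux {F W : Type*} [Field F] [AddCommGroup W] [Module F W]
    [FiniteDimensional F W] (X : Submodule F W) (Z : Submodule F (W ⧸ X)) :
    finrank F (Z.comap X.mkQ) = finrank F Z + finrank F X := by
  have h := finrank_map_aux X (Z.comap X.mkQ)
  rw [Submodule.map_comap_eq_of_surjective X.mkQ_surjective,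
    inf_eq_right.mpr (Submodule.le_comap_mkQ X Z)] at h
  exact h.symm

/-- Subspaces containing `Y` correspond to subspaces of the quotient. -/
theorem card_above {F W : Type*} [Field F] [AddCommGroup W] [Module F W]
    (Y : Submodule F W) (P : Submodule F W → Prop) :
    Nat.card {U : Submodule F W // Y ≤ U ∧ P U} =
      Nat.card {Z : Submodule F (W ⧸ Y) // P (Z.comap Y.mkQ)} := by
  symm
  apply Nat.card_congr
  refine Equiv.ofBijective (fun Z => ⟨Z.1.comap Y.mkQ, Submodule.le_comap_mkQ Y _, Z.2⟩) ⟨?_, ?_⟩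
  · rintro ⟨Z, hZ⟩ ⟨Z', hZ'⟩ h
    simp only [Subtype.mk.injEq] at h ⊢
    exact Submodule.comap_injective_of_surjective Y.mkQ_surjective h
  · rintro ⟨U, hU, hP⟩
    have e : (U.map Y.mkQ).comap Y.mkQ = U := by
      rw [Submodule.comap_map_mkQ]; exact sup_eq_right.mpr hU
    exact ⟨⟨U.map Y.mkQ, by rw [e]; exact hP⟩, by simp only [e]⟩

open Module in
/-- Counting subspaces which are disjoint from `X`. -/
theorem card_disjoint {F W : Type*} [Field F] [Fintype F] [AddCommGroup W] [Module F W]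
    [FiniteDimensional F W] (X : Submodule F W) (m : ℕ) :
    Nat.card {U : Submodule F W // Disjoint U X ∧ finrank F U = m} =
      Fintype.card F ^ (finrank F X * m) *
        Nat.card {Z : Submodule F (W ⧸ X) // finrank F Z = m} := by
  have : Finite W := Module.finite_of_finite F
  obtain ⟨σ, hσ⟩ := X.mkQ.exists_rightInverse_of_surjective X.range_mkQ
  have hσ' : ∀ z, X.mkQ (σ z) = z := fun z => LinearMap.congr_fun hσ z
  let φ : (Z : Submodule F (W ⧸ X)) → (Z →ₗ[F] X) → (Z →ₗ[F] W) :=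
    fun Z f => σ ∘ₗ Z.subtype + X.subtype ∘ₗ f
  have hφ : ∀ Z f z, X.mkQ (φ Z f z) = z := by
    intro Z f z
    have : X.mkQ (f z : W) = 0 := by simp
    simp only [φ, LinearMap.add_apply, LinearMap.comp_apply, map_add, Submodule.subtype_apply,
      hσ', this, add_zero]
  have hinj : ∀ Z f, Function.Injective (φ Z f) := by
    intro Z f a b h
    have := congrArg X.mkQ h
    rw [hφ, hφ] at this
    exact Subtype.ext this
  have hmap : ∀ Z f, (LinearMap.range (φ Z f)).map X.mkQ = Z := by
    intro Z f
    ext z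
    constructor
    · rintro ⟨_, ⟨y, rfl⟩, rfl⟩
      rw [hφ]; exact y.2
    · intro hz
      exact ⟨_, ⟨⟨z, hz⟩, rfl⟩, hφ _ _ _⟩
  have e : Nat.card (Σ Z : {Z : Submodule F (W ⧸ X) // finrank F Z = m}, (Z.1 →ₗ[F] X)) =
      Nat.card {U : Submodule F W // Disjoint U X ∧ finrank F U = m} := by
    apply Nat.card_congr
    refine Equiv.ofBijective (fun p => ⟨LinearMap.range (φ p.1.1 p.2), ?_, ?_⟩) ⟨?_, ?_⟩
    · rw [Submodule.disjoint_def]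
      rintro _ ⟨z, rfl⟩ hx
      have h0 : X.mkQ (φ p.1.1 p.2 z) = 0 := by simpa using hx
      rw [hφ] at h0
      have : z = 0 := Subtype.ext h0
      rw [this, map_zero]
    · rw [LinearMap.finrank_range_of_inj (hinj _ _)]; exact p.1.2
    · rintro ⟨⟨Z, hZ⟩, f⟩ ⟨⟨Z', hZ'⟩, f'⟩ h
      simp only [Subtype.mk.injEq] at h
      have hh : Z = Z' := by rw [← hmap Z f, h, hmap]
      subst hh
      have : f = f' := by
        ext z
        have hz : φ Z f z ∈ LinearMap.range (φ Z f') := h ▸ ⟨z, rfl⟩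
        obtain ⟨y, hy⟩ := hz
        have := congrArg X.mkQ hy
        rw [hφ, hφ] at this
        have hyz : y = z := Subtype.ext this
        subst hyz
        simpa [φ] using hy.symm
      rw [this]
    · rintro ⟨U, hU, hm⟩
      have hi : Function.Injective (X.mkQ.domRestrict U) := by
        rw [← LinearMap.ker_eq_bot, LinearMap.ker_eq_bot']
        intro x hx
        have : (x : W) ∈ X := by simpa using hx
        exact Subtype.ext (Submodule.disjoint_def.mp hU _ x.2 this)
      have hfr : finrank F (U.map X.mkQ) = m := by
        have h := finrank_map_aux X U
        rw [hU.eq_bot, finrank_bot] at h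
        omega
      let e0 := LinearEquiv.ofInjective _ hi
      let e1 : ↥(U.map X.mkQ) ≃ₗ[F] U :=
        (LinearEquiv.ofEq _ _ (LinearMap.range_domRestrict U X.mkQ).symm).trans e0.symm
      have he1 : ∀ z, X.mkQ (e1 z : W) = z := by
        intro z
        have h2 : ∀ w, X.mkQ (e0.symm w : W) = w := by
          intro w
          have := congrArg Subtype.val (e0.apply_symm_apply w)
          exact this
        exact h2 _
      let f : ↥(U.map X.mkQ) →ₗ[F] X :=
        LinearMap.codRestrict X (U.subtype ∘ₗ e1.toLinearMap - σ ∘ₗ (U.map X.mkQ).subtype) (by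
          intro z
          refine (Submodule.Quotient.mk_eq_zero X).mp ?_
          rw [← Submodule.mkQ_apply]
          simp only [LinearMap.sub_apply, LinearMap.comp_apply, map_sub, Submodule.subtype_apply,
            hσ', LinearEquiv.coe_coe, he1, sub_self])
      have hf : φ _ f = U.subtype ∘ₗ e1.toLinearMap := by
        ext z; simp [φ, f]
      refine ⟨⟨⟨U.map X.mkQ, hfr⟩, f⟩, ?_⟩
      simp only [Subtype.mk.injEq]
      rw [hf, LinearMap.range_comp, LinearEquiv.range, Submodule.map_top, Submodule.range_subtype]
  rw [← e]
  have : Finite (W ⧸ X) := Module.finite_of_finite F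
  have : Fintype {Z : Submodule F (W ⧸ X) // finrank F Z = m} := Fintype.ofFinite _
  have : ∀ Z : Submodule F (W ⧸ X), Finite (Z →ₗ[F] X) := fun Z => Module.finite_of_finite F
  rw [Nat.card_sigma]
  have hc : ∀ Z : {Z : Submodule F (W ⧸ X) // finrank F Z = m},
      Nat.card (Z.1 →ₗ[F] X) = Fintype.card F ^ (finrank F X * m) := by
    intro Z
    rw [Module.natCard_eq_pow_finrank (K := F), finrank_linearMap, Z.2, Nat.card_eq_fintype_card, mul_comm]
  simp only [hc, Finset.sum_const, Finset.card_univ, smul_eq_mul, Nat.card_eq_fintype_card]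
  rw [mul_comm]

open Module in
theorem card_gr {F : Type*} [Field F] [Fintype F] (n : ℕ) : ∀ (m : ℕ)
    (W : Type*) [AddCommGroup W] [Module F W] [FiniteDimensional F W], finrank F W = n →
    Nat.card {U : Submodule F W // finrank F U = m} = gbin (Fintype.card F) n m := by
  induction n with
  | zero =>
    intro m W _ _ _ h
    cases m with
    | zero =>
      rw [gbin]
      simp only [Submodule.finrank_eq_zero]
      simp
    | succ m =>
      rw [gbin]
      have : IsEmpty {U : Submodule F W // finrank F U = m + 1} := by
        constructor
        rintro ⟨U, hU⟩
        have := Submodule.finrank_le U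
        omega
      simp
  | succ n ih =>
    intro m W _ _ _ h
    have : Finite W := Module.finite_of_finite F
    cases m with
    | zero =>
      rw [gbin]
      simp only [Submodule.finrank_eq_zero]
      simp
    | succ m =>
      have : Nontrivial W := Module.nontrivial_of_finrank_pos (R := F) (by omega)
      obtain ⟨v, hv⟩ := exists_ne (0 : W)
      have hL : finrank F (F ∙ v) = 1 := finrank_span_singleton hv
      have hQ : finrank F (W ⧸ (F ∙ v)) = n := by
        have := Submodule.finrank_quotient_add_finrank (F ∙ v)
        omega
      rw [gbin]
      have h1 := card_above (F ∙ v) (fun U => finrank F U = m + 1)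
      simp only [finrank_comap_aux, hL, Nat.add_right_cancel_iff] at h1
      rw [ih _ _ hQ] at h1
      have h2 := card_disjoint (F ∙ v) (m + 1)
      rw [ih _ _ hQ, hL, one_mul] at h2
      rw [← h1, ← h2]
      have hd : ∀ U : Submodule F W, Disjoint U (F ∙ v) ↔ ¬ (F ∙ v) ≤ U := by
        intro U
        rw [Submodule.span_singleton_le_iff_mem, Submodule.disjoint_span_singleton' hv]
      simp only [hd]
      have := Set.ncard_inter_add_ncard_sdiff_eq_ncard {U : Submodule F W | finrank F U = m + 1}
        {U | (F ∙ v) ≤ U}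
      rw [← Nat.card_coe_set_eq, ← Nat.card_coe_set_eq, ← Nat.card_coe_set_eq] at this
      refine Eq.trans this.symm ?_
      congr 1
      · apply Nat.card_congr
        exact Equiv.subtypeEquivRight (fun U => and_comm)
      · apply Nat.card_congr
        exact Equiv.subtypeEquivRight (fun U => and_comm)

open Module in
theorem gbin_symm {F : Type*} [Field F] [Fintype F] (n m : ℕ) (h : m ≤ n) :
    gbin (Fintype.card F) n (n - m) = gbin (Fintype.card F) n m := by
  rw [← card_gr (F := F) n m (Fin n → F) (by simp),
    ← card_gr (F := F) n (n - m) (Dual F (Fin n → F)) (by simp)]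
  symm
  apply Nat.card_congr
  refine ((Subspace.orderIsoFiniteDimensional (K := F) (V := Fin n → F)).toEquiv.trans
    OrderDual.ofDual).subtypeEquiv ?_
  intro U
  have := Subspace.finrank_add_finrank_dualAnnihilator_eq U
  simp only [finrank_fin_fun] at this
  change _ ↔ finrank F U.dualAnnihilator = _
  omega

open Module in
theorem card_meet {F W : Type*} [Field F] [Fintype F] [AddCommGroup W] [Module F W]
    [FiniteDimensional F W] (X : Submodule F W) (n s m i : ℕ) (hn : finrank F W = n)
    (hs : finrank F X = s) (him : i ≤ m) :
    Nat.card {U : Submodule F W // finrank F U = m ∧ finrank F ↥(U ⊓ X) = i} =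
      Fintype.card F ^ ((s - i) * (m - i)) * gbin (Fintype.card F) s i *
        gbin (Fintype.card F) (n - s) (m - i) := by
  have : Finite W := Module.finite_of_finite F
  have e : Nat.card (Σ Y : {Y : Submodule F X // finrank F Y = i},
      {U : Submodule F W // Y.1.map X.subtype ≤ U ∧
        (finrank F U = m ∧ U ⊓ X = Y.1.map X.subtype)}) =
      Nat.card {U : Submodule F W // finrank F U = m ∧ finrank F ↥(U ⊓ X) = i} := by
    apply Nat.card_congr
    have hfm : ∀ Y : Submodule F X, finrank F (Y.map X.subtype) = finrank F Y :=
      fun Y => Submodule.finrank_map_subtype_eq X Y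
    refine Equiv.ofBijective (fun p => ⟨p.2.1, p.2.2.2.1, ?_⟩) ⟨?_, ?_⟩
    · rw [p.2.2.2.2, hfm]; exact p.1.2
    · rintro ⟨⟨Y, hY⟩, ⟨U, hU⟩⟩ ⟨⟨Y', hY'⟩, ⟨U', hU'⟩⟩ h
      simp only [Subtype.mk.injEq] at h
      subst h
      have : Y = Y' := Submodule.map_injective_of_injective X.injective_subtype
        (hU.2.2.symm.trans hU'.2.2)
      subst this
      rfl
    · rintro ⟨U, hm, hi⟩
      have hh : (U.comap X.subtype).map X.subtype = U ⊓ X := by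
        rw [Submodule.map_comap_subtype, inf_comm]
      refine ⟨⟨⟨U.comap X.subtype, ?_⟩, ⟨U, ?_, hm, hh.symm⟩⟩, rfl⟩
      · rw [← hfm, hh, hi]
      · rw [hh]; exact inf_le_left
  rw [← e]
  have : Fintype {Y : Submodule F X // finrank F Y = i} := Fintype.ofFinite _
  rw [Nat.card_sigma]
  have hc : ∀ Y : {Y : Submodule F X // finrank F Y = i},
      Nat.card {U : Submodule F W // Y.1.map X.subtype ≤ U ∧
        (finrank F U = m ∧ U ⊓ X = Y.1.map X.subtype)} =
      Fintype.card F ^ ((s - i) * (m - i)) * gbin (Fintype.card F) (n - s) (m - i) := by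
    rintro ⟨Y, hY⟩
    simp only
    have hf : finrank F (Y.map X.subtype) = i := by
      rw [Submodule.finrank_map_subtype_eq X Y, hY]
    have hle : Y.map X.subtype ≤ X := Submodule.map_subtype_le X Y
    generalize Y.map X.subtype = T at hf hle
    rw [card_above T (fun U => finrank F U = m ∧ U ⊓ X = T)]
    have hX : (X.map T.mkQ).comap T.mkQ = X := by
      rw [Submodule.comap_map_mkQ]; exact sup_eq_right.mpr hle
    have hT : (⊥ : Submodule F (W ⧸ T)).comap T.mkQ = T := by
      rw [Submodule.comap_bot, Submodule.ker_mkQ]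
    have hXf : finrank F (X.map T.mkQ) = s - i := by
      have := finrank_comap_aux T (X.map T.mkQ)
      rw [hX] at this
      omega
    have hq : finrank F ((W ⧸ T) ⧸ X.map T.mkQ) = n - s := by
      have h1 := Submodule.finrank_quotient_add_finrank T
      have h2 := Submodule.finrank_quotient_add_finrank (X.map T.mkQ)
      have h3 := Submodule.finrank_mono hle
      omega
    have h := card_disjoint (X.map T.mkQ) (m - i)
    rw [hXf, card_gr _ _ _ hq] at h
    rw [← h]
    apply Nat.card_congr
    apply Equiv.subtypeEquivRight
    intro Z
    rw [finrank_comap_aux, hf, and_comm, disjoint_iff]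
    refine and_congr ?_ (by omega)
    conv_lhs => rw [← hX]
    rw [← Submodule.comap_inf]
    refine Iff.trans (Eq.congr_right hT.symm) ?_
    exact (Submodule.comap_injective_of_surjective T.mkQ_surjective).eq_iff
  simp only [hc, Finset.sum_const, Finset.card_univ, smul_eq_mul]
  rw [← Nat.card_eq_fintype_card, card_gr s i X hs, mul_left_comm, mul_assoc]

theorem gbin_zero_of_lt (p n : ℕ) : ∀ m, n < m → gbin p n m = 0 := by
  induction n with
  | zero => intro m h; cases m with
    | zero => omega
    | succ m => rw [gbin]
  | succ n ih => intro m h; cases m with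
    | zero => omega
    | succ m => rw [gbin, ih m (by omega), ih (m + 1) (by omega)]; simp

theorem stmt4 (p : ℕ) (hp : IsPrimePow p) (F : Type*) [Field F] [Fintype F]
    (hF : Fintype.card F = p) (W : Type*) [AddCommGroup W] [Module F W]
    [FiniteDimensional F W] (t k ℓ j : ℕ) (ht : 0 < t) (htk : t ≤ k)
    (hW : Module.finrank F W = k + t)
    (V V' : Submodule F W) (hV : Module.finrank F V = t)
    (hV' : Module.finrank F V' = t) (hne : V ≠ V')
    (hmeet : Module.finrank F ↥(V ⊓ V') = ℓ) (hℓ : ℓ ≤ t - 1)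
    (hj1 : ℓ ≤ j) (hj2 : j ≤ t) :
    Nat.card {U : Submodule F W // V' ≤ U ∧ Module.finrank F U = k ∧
        Module.finrank F ↥(U ⊓ V) = j} =
      p ^ ((t - j) * (k + ℓ - t - j)) * gbin p (t - ℓ) (j - ℓ) *
        gbin p (k + ℓ - t) j := by
  subst hF
  rw [card_above V' (fun U => Module.finrank F U = k ∧ Module.finrank F ↥(U ⊓ V) = j)]
  have hQ : Module.finrank F (W ⧸ V') = k := by
    have := Submodule.finrank_quotient_add_finrank V'
    omega
  have hX : Module.finrank F (V.map V'.mkQ) = t - ℓ := by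
    have := finrank_map_aux V' V
    omega
  have key : ∀ Z : Submodule F (W ⧸ V'),
      (Module.finrank F (Z.comap V'.mkQ) = k ∧ Module.finrank F ↥(Z.comap V'.mkQ ⊓ V) = j) ↔
      (Module.finrank F Z = k - t ∧ Module.finrank F ↥(Z ⊓ V.map V'.mkQ) = j - ℓ) := by
    intro Z
    rw [finrank_comap_aux, hV', ← finrank_map_aux V' (Z.comap V'.mkQ ⊓ V)]
    have h1 : (Z.comap V'.mkQ ⊓ V) ⊓ V' = V ⊓ V' := by
      rw [inf_assoc]
      exact inf_eq_right.mpr (inf_le_right.trans (Submodule.le_comap_mkQ V' Z))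
    have h2 : (Z.comap V'.mkQ ⊓ V).map V'.mkQ = Z ⊓ V.map V'.mkQ := by
      ext x
      constructor
      · rintro ⟨y, ⟨hy1, hy2⟩, rfl⟩
        exact ⟨hy1, ⟨y, hy2, rfl⟩⟩
      · rintro ⟨hx, ⟨y, hy, rfl⟩⟩
        exact ⟨y, ⟨hx, hy⟩, rfl⟩
    rw [h1, h2, hmeet]
    omega
  rw [Nat.card_congr (Equiv.subtypeEquivRight key)]
  by_cases hc : j - ℓ ≤ k - t
  · rw [card_meet _ k (t - ℓ) (k - t) (j - ℓ) hQ hX hc]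
    have a1 : t - ℓ - (j - ℓ) = t - j := by omega
    have a2 : k - t - (j - ℓ) = k + ℓ - t - j := by omega
    have a3 : k - (t - ℓ) = k + ℓ - t := by omega
    rw [a1, a2, a3, gbin_symm (F := F) (k + ℓ - t) j (by omega)]
  · rw [gbin_zero_of_lt _ (k + ℓ - t) j (by omega), mul_zero]
    have : IsEmpty {Z : Submodule F (W ⧸ V') // Module.finrank F Z = k - t ∧
        Module.finrank F ↥(Z ⊓ V.map V'.mkQ) = j - ℓ} := by
      constructor
      rintro ⟨Z, h1, h2⟩
      have := Submodule.finrank_mono (inf_le_left : Z ⊓ V.map V'.mkQ ≤ Z)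
      omega
    simp
end

section
/- Let p be a prime power and V an m-dimensional vector space over F_p with m ≥ k + t, t ≤ k. Fix a t-dimensional subspace V₀ and a (k+t)-dimensional subspace W with V₀ ⊂ W. Then there exist integers f(ℓ), ℓ = 0, ..., t, and a positive integer m₀, such that for every t-dimensional subspace V' of W: ∑_{U} f(dim(U ∩ V₀)) = m₀ if V' = V₀ and = 0 otherwise, where the sum is over all k-dimensional subspaces U of W containing V'. -/
section aux
variable {F : Type*} [Field F]

theorem aux_glue {X Y : Type*} [AddCommGroup X] [Module F X] [AddCommGroup Y] [Module F Y]
    {P Q : Submodule F X} {P' Q' : Submodule F Y} (h : IsCompl P Q) (h' : IsCompl P' Q')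
    (e1 : P ≃ₗ[F] P') (e2 : Q ≃ₗ[F] Q') :
    ∃ e : X ≃ₗ[F] Y, (∀ x : P, e x = e1 x) ∧ (∀ x : Q, e x = e2 x) := by
  refine ⟨(Submodule.prodEquivOfIsCompl P Q h).symm ≪≫ₗ (e1.prodCongr e2) ≪≫ₗ
    (Submodule.prodEquivOfIsCompl P' Q' h'), ?_, ?_⟩
  · intro x
    simp
  · intro x
    simp

theorem aux_map_eq {X Y : Type*} [AddCommGroup X] [Module F X] [AddCommGroup Y] [Module F Y]
    [FiniteDimensional F Y]
    {P : Submodule F X} {Q : Submodule F Y} (e : X ≃ₗ[F] Y)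
    (hd : Module.finrank F P = Module.finrank F Q) (h : ∀ x ∈ P, e x ∈ Q) :
    P.map (e : X →ₗ[F] Y) = Q := by
  apply Submodule.eq_of_le_of_finrank_eq
  · rintro _ ⟨x, hx, rfl⟩
    exact h x hx
  · rw [LinearEquiv.finrank_map_eq, hd]

theorem aux_one {X Y : Type*} [AddCommGroup X] [Module F X] [AddCommGroup Y] [Module F Y]
    [FiniteDimensional F X] [FiniteDimensional F Y]
    (P : Submodule F X) (Q : Submodule F Y)
    (hd : Module.finrank F P = Module.finrank F Q)
    (hX : Module.finrank F X = Module.finrank F Y) :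
    ∃ e : X ≃ₗ[F] Y, ∀ x ∈ P, e x ∈ Q := by
  obtain ⟨P', hP⟩ := P.exists_isCompl
  obtain ⟨Q', hQ⟩ := Q.exists_isCompl
  have h1 := Submodule.finrank_add_eq_of_isCompl hP
  have h2 := Submodule.finrank_add_eq_of_isCompl hQ
  obtain ⟨e, he, -⟩ := aux_glue hP hQ (LinearEquiv.ofFinrankEq P Q hd)
    (LinearEquiv.ofFinrankEq P' Q' (by omega))
  refine ⟨e, fun x hx => ?_⟩
  have := he ⟨x, hx⟩
  simp only at this
  rw [this]
  exact Subtype.mem _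

theorem aux_sub {X Y : Type*} [AddCommGroup X] [Module F X] [AddCommGroup Y] [Module F Y]
    [FiniteDimensional F X] [FiniteDimensional F Y]
    (A P : Submodule F X) (B Q : Submodule F Y) (hA : A ≤ P) (hB : B ≤ Q)
    (hd : Module.finrank F A = Module.finrank F B)
    (hX : Module.finrank F P = Module.finrank F Q) :
    ∃ e : P ≃ₗ[F] Q, ∀ x : P, (x : X) ∈ A → (e x : Y) ∈ B := by
  obtain ⟨e, he⟩ := aux_one (A.comap P.subtype) (B.comap Q.subtype) (by
    rw [(Submodule.comapSubtypeEquivOfLe hA).finrank_eq,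
      (Submodule.comapSubtypeEquivOfLe hB).finrank_eq, hd]) hX
  exact ⟨e, fun x hx => he x hx⟩

theorem aux_decomp {X : Type*} [AddCommGroup X] [Module F X] (V₀ V' : Submodule F X) :
    ∃ C E : Submodule F X, (V' ⊓ V₀) ⊔ C = V' ∧ Disjoint (V' ⊓ V₀) C ∧ C ≤ E ∧ IsCompl V₀ E := by
  obtain ⟨D, hD⟩ := (V' ⊓ V₀).exists_isCompl
  have hC : Disjoint (D ⊓ V') V₀ := by
    rw [disjoint_iff_inf_le, inf_assoc]
    rw [inf_comm]
    exact hD.disjoint.le_bot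
  obtain ⟨E, hE, hE'⟩ := hC.exists_isCompl
  refine ⟨D ⊓ V', E, ?_, ?_, hE, hE'.symm⟩
  · rw [← sup_inf_assoc_of_le D (inf_le_left : V' ⊓ V₀ ≤ V'), hD.sup_eq_top, top_inf_eq]
  · exact hD.disjoint.mono_right inf_le_left

theorem aux_fr {X : Type*} [AddCommGroup X] [Module F X] [FiniteDimensional F X]
    {A C : Submodule F X} (h : Disjoint A C) :
    Module.finrank F ↥(A ⊔ C) = Module.finrank F A + Module.finrank F C := by
  have := Submodule.finrank_sup_add_finrank_inf_eq A C
  rw [h.eq_bot, finrank_bot] at this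
  simpa using this

theorem aux_trans {X : Type*} [AddCommGroup X] [Module F X] [FiniteDimensional F X]
    (V₀ V' V'' : Submodule F X) (h : Module.finrank F V' = Module.finrank F V'')
    (h0 : Module.finrank F ↥(V' ⊓ V₀) = Module.finrank F ↥(V'' ⊓ V₀)) :
    ∃ e : X ≃ₗ[F] X, V₀.map (e : X →ₗ[F] X) = V₀ ∧ V'.map (e : X →ₗ[F] X) = V'' := by
  obtain ⟨C, E, h1, h2, h3, h4⟩ := aux_decomp V₀ V'
  obtain ⟨C', E', h1', h2', h3', h4'⟩ := aux_decomp V₀ V''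
  have a1 := aux_fr h2
  have a2 := aux_fr h2'
  rw [h1] at a1
  rw [h1'] at a2
  have hC : Module.finrank F C = Module.finrank F C' := by omega
  have a3 := Submodule.finrank_add_eq_of_isCompl h4
  have a4 := Submodule.finrank_add_eq_of_isCompl h4'
  obtain ⟨e1, he1⟩ := aux_sub (V' ⊓ V₀) V₀ (V'' ⊓ V₀) V₀ inf_le_right inf_le_right h0 rfl
  obtain ⟨e2, he2⟩ := aux_sub C E C' E' h3 h3' hC (by omega)
  obtain ⟨e, k1, k2⟩ := aux_glue h4 h4' e1 e2
  refine ⟨e, aux_map_eq e rfl ?_, ?_⟩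
  · intro x hx
    have := k1 ⟨x, hx⟩
    simp only at this
    rw [this]
    exact Subtype.mem _
  · have b1 : (V' ⊓ V₀).map (e : X →ₗ[F] X) = V'' ⊓ V₀ := by
      refine aux_map_eq e h0 fun x hx => ?_
      have := k1 ⟨x, hx.2⟩
      simp only at this
      rw [this]
      exact he1 _ hx
    have b2 : C.map (e : X →ₗ[F] X) = C' := by
      refine aux_map_eq e hC fun x hx => ?_
      have := k2 ⟨x, h3 hx⟩
      simp only at this
      rw [this]
      exact he2 _ hx
    rw [← h1, Submodule.map_sup, b1, b2, h1']

theorem aux_between {X : Type*} [AddCommGroup X] [Module F X] [FiniteDimensional F X]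
    (C E : Submodule F X) (h : C ≤ E) (n : ℕ) (hn : Module.finrank F C ≤ n) :
    n ≤ Module.finrank F E →
    ∃ M : Submodule F X, C ≤ M ∧ M ≤ E ∧ Module.finrank F M = n := by
  induction n, hn using Nat.le_induction with
  | base => exact fun _ => ⟨C, le_rfl, h, rfl⟩
  | succ n hn ih =>
    intro hE
    obtain ⟨M, h1, h2, h3⟩ := ih (by omega)
    have : ∃ v ∈ E, v ∉ M := by
      by_contra! hcon
      have := Submodule.finrank_mono (show E ≤ M from hcon)
      omega
    obtain ⟨v, hv, hvM⟩ := this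
    refine ⟨M ⊔ F ∙ v, h1.trans le_sup_left, sup_le h2 (by simpa using hv), ?_⟩
    have hv0 : v ≠ 0 := by
      rintro rfl
      exact hvM M.zero_mem
    rw [aux_fr, h3, finrank_span_singleton hv0]
    exact (Submodule.disjoint_span_singleton' hv0).2 hvM

/-- number of `k`-subspaces above `V'` meeting `V₀` in dimension `j` -/
noncomputable def auxN {X : Type*} [AddCommGroup X] [Module F X] (V₀ : Submodule F X) (k : ℕ)
    (V' : Submodule F X) (j : ℕ) : ℕ :=
  Set.ncard {U : Submodule F X | (V' ≤ U ∧ Module.finrank F U = k) ∧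
    Module.finrank F ↥(U ⊓ V₀) = j}

theorem auxN_congr {X : Type*} [AddCommGroup X] [Module F X] [FiniteDimensional F X]
    (V₀ V' V'' : Submodule F X) (h : Module.finrank F V' = Module.finrank F V'')
    (h0 : Module.finrank F ↥(V' ⊓ V₀) = Module.finrank F ↥(V'' ⊓ V₀)) (k j : ℕ) :
    auxN V₀ k V' j = auxN V₀ k V'' j := by
  obtain ⟨e, he0, he⟩ := aux_trans V₀ V' V'' h h0
  unfold auxN
  have hm : ∀ U : Submodule F X, Module.finrank F ↥(U.map (e : X →ₗ[F] X) ⊓ V₀) =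
      Module.finrank F ↥(U ⊓ V₀) := by
    intro U
    conv_lhs => rw [← he0]
    rw [← Submodule.map_inf _ e.injective, LinearEquiv.finrank_map_eq]
  have hinj := Submodule.map_injective_of_injective (f := (e : X →ₗ[F] X)) e.injective
  refine Set.ncard_congr (fun U _ => U.map (e : X →ₗ[F] X)) ?_ ?_ ?_
  · rintro U ⟨⟨h1, h2⟩, h3⟩
    refine ⟨⟨?_, ?_⟩, ?_⟩
    · rw [← he]
      exact Submodule.map_mono h1
    · rw [LinearEquiv.finrank_map_eq, h2]
    · rw [hm, h3]
  · intro a b _ _ hab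
    exact hinj hab
  · rintro U ⟨⟨h1, h2⟩, h3⟩
    obtain ⟨U, rfl⟩ := Submodule.map_surjective_of_surjective (f := (e : X →ₗ[F] X)) e.surjective U
    rw [hm] at h3
    rw [LinearEquiv.finrank_map_eq] at h2
    refine ⟨U, ⟨⟨?_, h2⟩, h3⟩, rfl⟩
    rw [← he] at h1
    exact (Submodule.map_le_map_iff_of_injective e.injective _ _).1 h1

theorem auxN_pos {X : Type*} [AddCommGroup X] [Module F X] [FiniteDimensional F X] [Finite F]
    (V₀ V' : Submodule F X) (t k : ℕ) (htk : t ≤ k) (hX : Module.finrank F X = k + t)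
    (h0 : Module.finrank F V₀ = t) (h : Module.finrank F V' = t) :
    0 < auxN V₀ k V' (Module.finrank F ↥(V' ⊓ V₀)) := by
  have : Finite X := Module.finite_of_finite F
  have : Finite (Submodule F X) := Finite.of_injective _ SetLike.coe_injective
  unfold auxN
  rw [Set.ncard_pos]
  obtain ⟨C, E, h1, h2, h3, h4⟩ := aux_decomp V₀ V'
  have a1 := aux_fr h2
  rw [h1] at a1
  have a3 := Submodule.finrank_add_eq_of_isCompl h4
  obtain ⟨M, b1, b2, b3⟩ := aux_between C E h3 (k - Module.finrank F ↥(V' ⊓ V₀))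
    (by omega) (by omega)
  have hd : Disjoint V₀ M := h4.disjoint.mono_right b2
  refine ⟨(V' ⊓ V₀) ⊔ M, ⟨?_, ?_⟩, ?_⟩
  · conv_lhs => rw [← h1]
    exact sup_le_sup_left b1 _
  · rw [aux_fr (hd.mono_left inf_le_right), b3]
    omega
  · rw [sup_inf_assoc_of_le _ (inf_le_right : V' ⊓ V₀ ≤ V₀), hd.symm.eq_bot, sup_bot_eq]

theorem auxN_zero {X : Type*} [AddCommGroup X] [Module F X] [FiniteDimensional F X]
    (V₀ V' : Submodule F X) (k j : ℕ) (hj : j < Module.finrank F ↥(V' ⊓ V₀)) :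
    auxN V₀ k V' j = 0 := by
  unfold auxN
  convert Set.ncard_empty (Submodule F X)
  ext U
  simp only [Set.mem_ofPred_eq, Set.mem_empty_iff_false, iff_false]
  rintro ⟨⟨h1, h2⟩, h3⟩
  have := Submodule.finrank_mono (inf_le_inf_right V₀ h1)
  omega

theorem aux_sum {X : Type*} [AddCommGroup X] [Module F X] [FiniteDimensional F X] [Finite F]
    (V₀ V' : Submodule F X) (k t : ℕ) (h0 : Module.finrank F V₀ = t) (f : ℕ → ℤ) :
    (∑ᶠ U ∈ {U : Submodule F X | V' ≤ U ∧ Module.finrank F U = k},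
      f (Module.finrank F ↥(U ⊓ V₀))) = ∑ j : Fin (t + 1), (auxN V₀ k V' j : ℤ) * f j := by
  classical
  have : Finite X := Module.finite_of_finite F
  have : Finite (Submodule F X) := Finite.of_injective _ SetLike.coe_injective
  rw [finsum_mem_eq_finite_toFinset_sum _ (Set.toFinite _)]
  rw [Fin.sum_univ_eq_sum_range (fun j => (auxN V₀ k V' j : ℤ) * f j) (t + 1)]
  rw [← Finset.sum_fiberwise_of_maps_to (t := Finset.range (t + 1))
    (g := fun U : Submodule F X => Module.finrank F ↥(U ⊓ V₀))]
  · refine Finset.sum_congr rfl fun j _ => ?_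
    rw [Finset.sum_congr rfl (g := fun _ => f j)]
    · rw [Finset.sum_const, nsmul_eq_mul]
      congr 2
      unfold auxN
      rw [← Set.ncard_coe_finset]
      congr 1
      ext U
      simp
    · intro U hU
      rw [(Finset.mem_filter.1 hU).2]
  · intro U _
    rw [Finset.mem_range]
    have := Submodule.finrank_mono (inf_le_right : U ⊓ V₀ ≤ V₀)
    omega

theorem aux_core {X : Type*} [AddCommGroup X] [Module F X] [FiniteDimensional F X] [Finite F]
    (V₀ : Submodule F X) (t k : ℕ) (htk : t ≤ k) (hX : Module.finrank F X = k + t)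
    (h0 : Module.finrank F V₀ = t) :
    ∃ (f : ℕ → ℤ) (m₀ : ℤ), 0 < m₀ ∧
      ∀ V' : Submodule F X, Module.finrank F V' = t →
        (∑ᶠ U ∈ {U : Submodule F X | V' ≤ U ∧ Module.finrank F U = k},
            f (Module.finrank F ↥(U ⊓ V₀))) =
          (open Classical in if V' = V₀ then m₀ else 0) := by
  classical
  have hex : ∀ l : Fin (t + 1), ∃ d : Fin (t + 1) → ℤ, 0 < d l ∧ (∀ j < l, d j = 0) ∧
      ∀ V' : Submodule F X, Module.finrank F V' = t → Module.finrank F ↥(V' ⊓ V₀) = l →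
        ∀ j : Fin (t + 1), (auxN V₀ k V' j : ℤ) = d j := by
    intro l
    by_cases hl : ∃ V' : Submodule F X, Module.finrank F V' = t ∧ Module.finrank F ↥(V' ⊓ V₀) = l
    · obtain ⟨V1, hV1, hl1⟩ := hl
      refine ⟨fun j => auxN V₀ k V1 j, ?_, ?_, ?_⟩
      · have := auxN_pos V₀ V1 t k htk hX h0 hV1
        rw [hl1] at this
        exact Int.natCast_pos.2 this
      · intro j hj
        have := auxN_zero V₀ V1 k j (by rw [hl1]; exact hj)
        simp [this]
      · intro V' h1 h2 j
        rw [auxN_congr V₀ V' V1 (by rw [h1, hV1]) (by rw [h2, hl1])]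
    · refine ⟨Pi.single l 1, by simp, fun j hj => by simp [hj.ne], ?_⟩
      intro V' h1 h2
      exact absurd ⟨V', h1, h2⟩ hl
  choose d hd1 hd2 hd3 using hex
  let D : Matrix (Fin (t + 1)) (Fin (t + 1)) ℤ := Matrix.of d
  have hdet : 0 < D.det := by
    rw [Matrix.det_of_isUpperTriangular (by intro i j hij; exact hd2 i j hij)]
    exact Finset.prod_pos fun i _ => hd1 i
  let g : Fin (t + 1) → ℤ := fun j => D.adjugate j (Fin.last t)
  refine ⟨fun n => if h : n < t + 1 then g ⟨n, h⟩ else 0, D.det, hdet, ?_⟩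
  intro V' hV'
  refine (aux_sum V₀ V' k t h0 (fun n => if h : n < t + 1 then g ⟨n, h⟩ else 0)).trans ?_
  have hle : Module.finrank F ↥(V' ⊓ V₀) < t + 1 := by
    have := Submodule.finrank_mono (inf_le_right : V' ⊓ V₀ ≤ V₀)
    omega
  have key := hd3 ⟨_, hle⟩ V' hV' rfl
  have hmul := congrFun (congrFun (Matrix.mul_adjugate D) ⟨_, hle⟩) (Fin.last t)
  rw [Matrix.mul_apply] at hmul
  simp only [key, Fin.is_lt, dif_pos, Fin.eta]
  refine hmul.trans ?_
  rw [Matrix.smul_apply, Matrix.one_apply]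
  have hiff : ((⟨_, hle⟩ : Fin (t + 1)) = Fin.last t) ↔ V' = V₀ := by
    rw [Fin.ext_iff]
    constructor
    · intro h
      have h : Module.finrank F ↥(V' ⊓ V₀) = t := h
      have e1 := Submodule.eq_of_le_of_finrank_eq (inf_le_right : V' ⊓ V₀ ≤ V₀) (by omega)
      have e2 := Submodule.eq_of_le_of_finrank_eq (inf_le_left : V' ⊓ V₀ ≤ V') (by omega)
      rw [← e2, e1]
    · rintro rfl
      change Module.finrank F ↥(V' ⊓ V') = t
      rw [inf_idem, h0]
  by_cases hc : V' = V₀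
  · rw [if_pos (hiff.2 hc), if_pos hc]; simp
  · rw [if_neg (fun h => hc (hiff.1 h)), if_neg hc]; simp

end aux

open Classical in

theorem stmt8 (p : ℕ) (hp : IsPrimePow p) (F : Type*) [Field F] [Fintype F]
    (hF : Fintype.card F = p) (V : Type*) [AddCommGroup V] [Module F V]
    [FiniteDimensional F V] (m t k : ℕ) (ht : 0 < t) (htk : t ≤ k)
    (hm : k + t ≤ m) (hdim : Module.finrank F V = m)
    (V₀ W : Submodule F V) (hV₀ : Module.finrank F V₀ = t)
    (hW : Module.finrank F W = k + t) (hsub : V₀ ≤ W) :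
    ∃ (f : ℕ → ℤ) (m₀ : ℤ), 0 < m₀ ∧
      ∀ V' : Submodule F V, V' ≤ W → Module.finrank F V' = t →
        (∑ᶠ U ∈ {U : Submodule F V | U ≤ W ∧ V' ≤ U ∧ Module.finrank F U = k},
            f (Module.finrank F ↥(U ⊓ V₀))) =
          if V' = V₀ then m₀ else 0 := by
  have hfr : ∀ U : Submodule F W, Module.finrank F ↥(U.map W.subtype) = Module.finrank F U :=
    fun U => (Submodule.equivMapOfInjective W.subtype W.injective_subtype U).finrank_eq.symm
  have hmc : ∀ U : Submodule F V, U ≤ W → ∃ U' : Submodule F W, U = U'.map W.subtype := by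
    intro U hU
    refine ⟨U.comap W.subtype, ?_⟩
    rw [Submodule.map_comap_subtype, inf_eq_right.2 hU]
  have hinj := Submodule.map_injective_of_injective W.injective_subtype
  obtain ⟨V₀, rfl⟩ := hmc V₀ hsub
  rw [hfr] at hV₀
  obtain ⟨f, m₀, hm₀, H⟩ := aux_core V₀ t k htk hW hV₀
  refine ⟨f, m₀, hm₀, ?_⟩
  intro V' hV' hd
  obtain ⟨V', rfl⟩ := hmc V' hV'
  rw [hfr] at hd
  have := H V' hd
  simp only [hinj.eq_iff]
  rw [← this]
  symm
  refine finsum_mem_eq_of_bijOn (fun U => U.map W.subtype) ⟨?_, hinj.injOn, ?_⟩ ?_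
  · rintro U ⟨h1, h2⟩
    exact ⟨Submodule.map_subtype_le _ _, Submodule.map_mono h1, by rw [hfr, h2]⟩
  · rintro U ⟨h1, h2, h3⟩
    obtain ⟨U, rfl⟩ := hmc U h1
    rw [hfr] at h3
    exact ⟨U, ⟨(Submodule.map_le_map_iff_of_injective W.injective_subtype _ _).1 h2, h3⟩, rfl⟩
  · intro U _
    rw [← Submodule.map_inf _ W.injective_subtype, hfr]
end
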